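/- Averaged Riesz-mass bound: let u be subharmonic on an open set Ω ⊆ ℝ^m and K ⊆ Ω compact with K + B(0, √δ₀) ⋐ Ω for some δ₀ ∈ (0,1), and suppose M := Δu(K + B(0,√δ₀)) < ∞. Then for every δ ∈ (0, δ₀), ∫_K (û_{√δ}(z) − u(z)) dV(z) ≤ C · δ · M for a constant C depending only on the dimension m, where û_{√δ} is the solid average on balls of radius √δ. -/

import Mathlib

open Set Metric MeasureTheory Pointwise

/-- A function is subharmonic on `Ω ⊆ ℝ^m` if it is upper semicontinuous on `Ω` and
satisfies the sub-mean-value inequality on every closed ball contained in `Ω`. -/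
def IsSubharmonicOn {m : ℕ} (Ω : Set (EuclideanSpace ℝ (Fin m)))
    (u : EuclideanSpace ℝ (Fin m) → ℝ) : Prop :=
  UpperSemicontinuousOn u Ω ∧
    ∀ (z : EuclideanSpace ℝ (Fin m)) (r : ℝ), 0 < r → Metric.closedBall z r ⊆ Ω →
      u z ≤ (volume (Metric.ball z r)).toReal⁻¹ * ∫ w in Metric.ball z r, u w

/-- The Laplacian of a twice differentiable function, as the trace of the second derivative. -/
noncomputable def lap {m : ℕ} (φ : EuclideanSpace ℝ (Fin m) → ℝ)
    (x : EuclideanSpace ℝ (Fin m)) : ℝ :=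
  ∑ i : Fin m, iteratedFDeriv ℝ 2 φ x
    ![EuclideanSpace.single i (1 : ℝ), EuclideanSpace.single i (1 : ℝ)]

/-- The Lipschitz radial profile `(1 - ‖w‖²)₊ / 2`, whose gradient on the unit ball is `-w`. -/
noncomputable def radialProfile {m : ℕ} (w : EuclideanSpace ℝ (Fin m)) : ℝ :=
  (1 - (min ‖w‖ 1) ^ 2) / 2

section RadialProfile

variable {m : ℕ}

lemma radialProfile_nonneg (w : EuclideanSpace ℝ (Fin m)) : 0 ≤ radialProfile w := by
  have h1 : 0 ≤ min ‖w‖ 1 := le_min (norm_nonneg w) zero_le_one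
  have h2 : min ‖w‖ 1 ≤ 1 := min_le_right _ _
  unfold radialProfile
  nlinarith

lemma radialProfile_le_one (w : EuclideanSpace ℝ (Fin m)) : radialProfile w ≤ 1 := by
  unfold radialProfile
  nlinarith [sq_nonneg (min ‖w‖ 1)]

lemma radialProfile_eq_zero {w : EuclideanSpace ℝ (Fin m)} (hw : 1 ≤ ‖w‖) :
    radialProfile w = 0 := by
  simp [radialProfile, min_eq_right hw]

lemma continuous_radialProfile : Continuous (radialProfile (m := m)) := by
  unfold radialProfile
  fun_prop

lemma lipschitzWith_radialProfile : LipschitzWith 1 (radialProfile (m := m)) := by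
  refine LipschitzWith.of_dist_le_mul fun x y => ?_
  have hx0 : 0 ≤ min ‖x‖ 1 := le_min (norm_nonneg x) zero_le_one
  have hx1 : min ‖x‖ 1 ≤ 1 := min_le_right _ _
  have hy0 : 0 ≤ min ‖y‖ 1 := le_min (norm_nonneg y) zero_le_one
  have hy1 : min ‖y‖ 1 ≤ 1 := min_le_right _ _
  have hxy : |min ‖x‖ 1 - min ‖y‖ 1| ≤ dist x y := by
    have h := abs_min_sub_min_le_max ‖x‖ 1 ‖y‖ 1
    rw [sub_self, abs_zero, max_eq_left (abs_nonneg _)] at h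
    exact h.trans ((abs_norm_sub_norm_le x y).trans_eq (dist_eq_norm x y).symm)
  have hfactor : radialProfile x - radialProfile y =
      -((min ‖x‖ 1 - min ‖y‖ 1) * ((min ‖x‖ 1 + min ‖y‖ 1) / 2)) := by
    unfold radialProfile
    ring
  rw [Real.dist_eq, hfactor, abs_neg, abs_mul, abs_of_nonneg (a := (_ + _) / 2) (by positivity),
    NNReal.coe_one, one_mul]
  nlinarith [abs_nonneg (min ‖x‖ 1 - min ‖y‖ 1)]

lemma lineDeriv_radialProfile_of_norm_lt_one {w : EuclideanSpace ℝ (Fin m)} (hw : ‖w‖ < 1)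
    (i : Fin m) :
    lineDeriv ℝ radialProfile w (EuclideanSpace.single i (1 : ℝ)) = -w i := by
  have hd : HasFDerivAt (fun x : EuclideanSpace ℝ (Fin m) => (1 - ‖x‖ ^ 2) / 2)
      ((2 : ℝ)⁻¹ • -((2 : ℕ) • innerSL ℝ w : EuclideanSpace ℝ (Fin m) →L[ℝ] ℝ)) w := by
    simpa [div_eq_inv_mul] using
      (((hasStrictFDerivAt_norm_sq w).hasFDerivAt.const_sub 1).const_mul (2 : ℝ)⁻¹)
  have heq : radialProfile =ᶠ[nhds w]
      fun x : EuclideanSpace ℝ (Fin m) => (1 - ‖x‖ ^ 2) / 2 := by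
    filter_upwards [(continuous_norm.isOpen_preimage _ isOpen_Iio).mem_nhds
      (show w ∈ norm ⁻¹' Iio (1 : ℝ) from hw)] with x hx
    simp [radialProfile, min_eq_left (le_of_lt (show ‖x‖ < 1 from hx))]
  rw [((hd.congr_of_eventuallyEq heq).hasLineDerivAt _).lineDeriv]
  simp [EuclideanSpace.inner_single_right]

lemma lineDeriv_radialProfile_of_one_lt_norm {w : EuclideanSpace ℝ (Fin m)} (hw : 1 < ‖w‖)
    (v : EuclideanSpace ℝ (Fin m)) : lineDeriv ℝ radialProfile w v = 0 := by
  have heq : radialProfile =ᶠ[nhds w] fun _ : EuclideanSpace ℝ (Fin m) => (0 : ℝ) := by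
    filter_upwards [(continuous_norm.isOpen_preimage _ isOpen_Ioi).mem_nhds
      (show w ∈ norm ⁻¹' Ioi (1 : ℝ) from hw)] with x hx
    exact radialProfile_eq_zero (le_of_lt hx)
  rw [(((hasFDerivAt_const (0 : ℝ) w).congr_of_eventuallyEq heq).hasLineDerivAt _).lineDeriv]
  simp

lemma setIntegral_ball_coord_mul {g : EuclideanSpace ℝ (Fin m) → ℝ} (hg : ContDiff ℝ 1 g)
    (hgs : HasCompactSupport g) (i : Fin m) :
    ∫ w in ball (0 : EuclideanSpace ℝ (Fin m)) 1, w i * g w =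
      ∫ w, radialProfile w * fderiv ℝ g w (EuclideanSpace.single i (1 : ℝ)) := by
  obtain ⟨D, hD⟩ := hg.lipschitzWith_of_hasCompactSupport hgs one_ne_zero
  have h := lipschitzWith_radialProfile.integral_lineDeriv_mul_eq (μ := volume) hD hgs
    (EuclideanSpace.single i (1 : ℝ))
  have hl : ∫ w, lineDeriv ℝ radialProfile w (EuclideanSpace.single i (1 : ℝ)) * g w =
      -∫ w in ball (0 : EuclideanSpace ℝ (Fin m)) 1, w i * g w := by
    rw [← integral_neg, ← integral_indicator measurableSet_ball]
    refine integral_congr_ae ?_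
    have hs : ∀ᵐ w : EuclideanSpace ℝ (Fin m), w ∉ sphere (0 : EuclideanSpace ℝ (Fin m)) 1 :=
      measure_eq_zero_iff_ae_notMem.1 (Measure.addHaar_sphere_of_ne_zero volume _ one_ne_zero)
    filter_upwards [hs] with w hw
    rw [mem_sphere_zero_iff_norm] at hw
    rcases lt_or_gt_of_ne hw with h1 | h1
    · rw [lineDeriv_radialProfile_of_norm_lt_one h1,
        indicator_of_mem (by simpa using h1), neg_mul]
    · rw [lineDeriv_radialProfile_of_one_lt_norm h1,
        indicator_of_notMem (by simpa using h1.le), zero_mul]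
  have hr : ∫ w, lineDeriv ℝ g w (-EuclideanSpace.single i (1 : ℝ)) * radialProfile w =
      -∫ w, radialProfile w * fderiv ℝ g w (EuclideanSpace.single i (1 : ℝ)) := by
    rw [← integral_neg]
    refine integral_congr_ae (Filter.Eventually.of_forall fun w => ?_)
    simp only [((hg.differentiable one_ne_zero).differentiableAt).lineDeriv_eq_fderiv, map_neg]
    ring
  linarith

end RadialProfile

section WeightedTranslates

variable {α : Type*} [MeasurableSpace α] {ρ : Measure α} {a : α → ℝ}
  {E F : Type} [NormedAddCommGroup E] [NormedSpace ℝ E] [FiniteDimensional ℝ E]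
  [MeasurableSpace E] [BorelSpace E] [NormedAddCommGroup F] [NormedSpace ℝ F]
  {s : α → E} {g : E → F}

lemma integrable_smul_comp_sub (ha : Integrable a ρ) (hs : Measurable s)
    (hg : Continuous g) (hgs : HasCompactSupport g) (z : E) :
    Integrable (fun p => a p • g (z - s p)) ρ := by
  obtain ⟨C, hC⟩ := hgs.exists_bound_of_continuous hg
  refine (ha.norm.mul_const C).mono' (ha.aestronglyMeasurable.smul
    (hg.comp_aestronglyMeasurable (hs.const_sub z).aestronglyMeasurable)) ?_
  filter_upwards with p
  rw [norm_smul]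
  exact mul_le_mul_of_nonneg_left (hC _) (norm_nonneg _)

lemma hasFDerivAt_integral_smul_comp_sub (ha : Integrable a ρ) (hs : Measurable s)
    (hg : ContDiff ℝ 1 g) (hgs : HasCompactSupport g) (z : E) :
    HasFDerivAt (fun z => ∫ p, a p • g (z - s p) ∂ρ)
      (∫ p, a p • fderiv ℝ g (z - s p) ∂ρ) z := by
  have hg' := hg.continuous_fderiv one_ne_zero
  obtain ⟨C, hC⟩ := (hgs.fderiv ℝ).exists_bound_of_continuous hg'
  refine hasFDerivAt_integral_of_dominated_of_fderiv_le (s := univ)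
    (F' := fun z p => a p • fderiv ℝ g (z - s p)) (bound := fun p => ‖a p‖ * C) Filter.univ_mem
    (Filter.Eventually.of_forall fun x =>
      (integrable_smul_comp_sub ha hs hg.continuous hgs x).aestronglyMeasurable)
    (integrable_smul_comp_sub ha hs hg.continuous hgs z)
    (integrable_smul_comp_sub ha hs hg' (hgs.fderiv ℝ) z).aestronglyMeasurable
    ?_ (ha.norm.mul_const C) ?_
  · filter_upwards with p x _
    rw [norm_smul]
    exact mul_le_mul_of_nonneg_left (hC _) (norm_nonneg _)
  · filter_upwards with p x _
    have h := ((hg.differentiable one_ne_zero) (x - s p)).hasFDerivAt.comp x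
      ((hasFDerivAt_id x).sub_const (s p))
    exact h.const_smul (a p)

lemma fderiv_integral_smul_comp_sub (ha : Integrable a ρ) (hs : Measurable s)
    (hg : ContDiff ℝ 1 g) (hgs : HasCompactSupport g) :
    fderiv ℝ (fun z => ∫ p, a p • g (z - s p) ∂ρ) =
      fun z => ∫ p, a p • fderiv ℝ g (z - s p) ∂ρ :=
  funext fun z => (hasFDerivAt_integral_smul_comp_sub ha hs hg hgs z).fderiv

lemma contDiff_nat_integral_smul_comp_sub (ha : Integrable a ρ) (hs : Measurable s) (n : ℕ) :
    ∀ {F : Type} [NormedAddCommGroup F] [NormedSpace ℝ F] {g : E → F}, ContDiff ℝ n g →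
      HasCompactSupport g → ContDiff ℝ n (fun z => ∫ p, a p • g (z - s p) ∂ρ) := by
  induction n with
  | zero =>
    intro F _ _ g hg hgs
    have hg0 : Continuous g := hg.continuous
    obtain ⟨C, hC⟩ := hgs.exists_bound_of_continuous hg0
    refine contDiff_zero.2 (continuous_of_dominated (bound := fun p => ‖a p‖ * C)
      (fun z => (integrable_smul_comp_sub ha hs hg0 hgs z).aestronglyMeasurable) (fun z => ?_)
      (ha.norm.mul_const C) ?_)
    · filter_upwards with p
      rw [norm_smul]
      exact mul_le_mul_of_nonneg_left (hC _) (norm_nonneg _)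
    · filter_upwards with p
      fun_prop
  | succ n ih =>
    intro F _ _ g hg hgs
    have hg1 : ContDiff ℝ 1 g := hg.of_le (by exact_mod_cast Nat.le_add_left 1 n)
    rw [show ((n + 1 : ℕ) : WithTop ℕ∞) = n + 1 by push_cast; rfl] at hg ⊢
    refine contDiff_succ_iff_fderiv.2 ⟨fun z =>
      (hasFDerivAt_integral_smul_comp_sub ha hs hg1 hgs z).differentiableAt, by simp, ?_⟩
    rw [fderiv_integral_smul_comp_sub ha hs hg1 hgs]
    exact ih (hg.fderiv_right le_rfl) (hgs.fderiv ℝ)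

lemma contDiff_integral_smul_comp_sub (ha : Integrable a ρ) (hs : Measurable s)
    (hg : ContDiff ℝ (⊤ : ℕ∞) g) (hgs : HasCompactSupport g) :
    ContDiff ℝ (⊤ : ℕ∞) (fun z => ∫ p, a p • g (z - s p) ∂ρ) :=
  contDiff_infty.2 fun n =>
    contDiff_nat_integral_smul_comp_sub ha hs n (contDiff_infty.1 hg n) hgs

end WeightedTranslates

section Laplacian

variable {m : ℕ}

lemma lap_eq_sum_fderiv (φ : EuclideanSpace ℝ (Fin m) → ℝ) (x : EuclideanSpace ℝ (Fin m)) :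
    lap φ x = ∑ i : Fin m, fderiv ℝ (fderiv ℝ φ) x
      (EuclideanSpace.single i (1 : ℝ)) (EuclideanSpace.single i (1 : ℝ)) := by
  simp [lap, iteratedFDeriv_two_apply]

lemma continuous_lap {φ : EuclideanSpace ℝ (Fin m) → ℝ} (hφ : ContDiff ℝ 2 φ) :
    Continuous (lap φ) := by
  have h : Continuous (fderiv ℝ (fderiv ℝ φ)) :=
    (hφ.fderiv_right (m := 1) (by norm_num)).continuous_fderiv one_ne_zero
  simp only [funext (lap_eq_sum_fderiv φ)]
  fun_prop

lemma lap_integral_smul_comp_sub {α : Type*} [MeasurableSpace α] {ρ : Measure α} {a : α → ℝ}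
    {s : α → EuclideanSpace ℝ (Fin m)} {φ : EuclideanSpace ℝ (Fin m) → ℝ}
    (ha : Integrable a ρ) (hs : Measurable s) (hφ : ContDiff ℝ 2 φ) (hφs : HasCompactSupport φ)
    (z : EuclideanSpace ℝ (Fin m)) :
    lap (fun z => ∫ p, a p • φ (z - s p) ∂ρ) z = ∫ p, a p * lap φ (z - s p) ∂ρ := by
  have hφ' : ContDiff ℝ 1 (fderiv ℝ φ) := hφ.fderiv_right (by norm_num)
  have hi := integrable_smul_comp_sub ha hs (hφ'.continuous_fderiv one_ne_zero)
    ((hφs.fderiv ℝ).fderiv ℝ) z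
  rw [lap_eq_sum_fderiv, fderiv_integral_smul_comp_sub ha hs (hφ.of_le one_le_two) hφs,
    fderiv_integral_smul_comp_sub ha hs hφ' (hφs.fderiv ℝ)]
  simp only [lap_eq_sum_fderiv, Finset.mul_sum]
  rw [integral_finsetSum]
  · refine Finset.sum_congr rfl fun i _ => ?_
    rw [ContinuousLinearMap.integral_apply hi,
      ContinuousLinearMap.integral_apply (hi.apply_continuousLinearMap _)]
    simp
  · intro i _
    simpa using (hi.apply_continuousLinearMap (EuclideanSpace.single i (1 : ℝ))
      ).apply_continuousLinearMap (EuclideanSpace.single i (1 : ℝ))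

lemma setIntegral_ball_fderiv_apply_self {φ : EuclideanSpace ℝ (Fin m) → ℝ}
    (hφ : ContDiff ℝ 2 φ) (hφs : HasCompactSupport φ) (z : EuclideanSpace ℝ (Fin m))
    {t : ℝ} (ht : t ≠ 0) :
    ∫ w in ball (0 : EuclideanSpace ℝ (Fin m)) 1, fderiv ℝ φ (z - t • w) w =
      -∫ w in ball (0 : EuclideanSpace ℝ (Fin m)) 1,
        t * radialProfile w * lap φ (z - t • w) := by
  have hφ' : ContDiff ℝ 1 (fderiv ℝ φ) := hφ.fderiv_right (by norm_num)
  have hφc : Continuous (fderiv ℝ (fderiv ℝ φ)) := hφ'.continuous_fderiv one_ne_zero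
  have hint : ∀ f : EuclideanSpace ℝ (Fin m) → ℝ, Continuous f →
      IntegrableOn f (ball (0 : EuclideanSpace ℝ (Fin m)) 1) := fun f hf =>
    (hf.continuousOn.integrableOn_compact (isCompact_closedBall 0 1)).mono_set
      ball_subset_closedBall
  have hcoord : ∀ i : Fin m,
      ∫ w in ball (0 : EuclideanSpace ℝ (Fin m)) 1,
        w i * fderiv ℝ φ (z - t • w) (EuclideanSpace.single i (1 : ℝ)) =
      -∫ w in ball (0 : EuclideanSpace ℝ (Fin m)) 1, t * radialProfile w *
        fderiv ℝ (fderiv ℝ φ) (z - t • w) (EuclideanSpace.single i (1 : ℝ))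
          (EuclideanSpace.single i (1 : ℝ)) := by
    intro i
    have hsupp : HasCompactSupport fun w =>
        fderiv ℝ φ (z - t • w) (EuclideanSpace.single i (1 : ℝ)) := by
      have h := (hφs.fderiv_apply ℝ (EuclideanSpace.single i (1 : ℝ))).comp_homeomorph
        ((Homeomorph.smulOfNeZero t ht).trans (Homeomorph.subLeft z))
      exact h
    have hdiff : ContDiff ℝ 1 fun w =>
        fderiv ℝ φ (z - t • w) (EuclideanSpace.single i (1 : ℝ)) := by
      fun_prop
    have hd : ∀ w : EuclideanSpace ℝ (Fin m),
        fderiv ℝ (fun w => fderiv ℝ φ (z - t • w) (EuclideanSpace.single i (1 : ℝ))) w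
          (EuclideanSpace.single i (1 : ℝ)) =
        -(t * fderiv ℝ (fderiv ℝ φ) (z - t • w) (EuclideanSpace.single i (1 : ℝ))
          (EuclideanSpace.single i (1 : ℝ))) := by
      intro w
      have h0 : HasFDerivAt (fun w => z - t • w)
          (-(t • ContinuousLinearMap.id ℝ (EuclideanSpace ℝ (Fin m)))) w :=
        ((hasFDerivAt_id w).const_smul t).const_sub z
      have h1 : HasFDerivAt (fun w => fderiv ℝ φ (z - t • w)) _ w :=
        ((hφ'.differentiable one_ne_zero) (z - t • w)).hasFDerivAt.comp w h0
      rw [(h1.clm_apply (hasFDerivAt_const (EuclideanSpace.single i (1 : ℝ)) w)).fderiv]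
      simp
    rw [setIntegral_ball_coord_mul hdiff hsupp, ← integral_neg,
      ← integral_indicator measurableSet_ball]
    refine integral_congr_ae (Filter.Eventually.of_forall fun w => ?_)
    beta_reduce
    rw [hd]
    by_cases hw : w ∈ ball (0 : EuclideanSpace ℝ (Fin m)) 1
    · rw [indicator_of_mem hw]
      ring
    · rw [indicator_of_notMem hw, radialProfile_eq_zero (by simpa using hw), zero_mul]
  have hexp : ∀ (L : EuclideanSpace ℝ (Fin m) →L[ℝ] ℝ) (w : EuclideanSpace ℝ (Fin m)),
      L w = ∑ i, w i * L (EuclideanSpace.single i (1 : ℝ)) := by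
    intro L w
    conv_lhs => rw [← (EuclideanSpace.basisFun (Fin m) ℝ).sum_repr w]
    simp
  simp_rw [fun w => hexp (fderiv ℝ φ (z - t • w)) w, lap_eq_sum_fderiv, Finset.mul_sum]
  rw [integral_finsetSum, integral_finsetSum, ← Finset.sum_neg_distrib]
  · exact Finset.sum_congr rfl fun i _ => hcoord i
  · intro i _
    refine hint _ ?_
    have := continuous_radialProfile (m := m)
    fun_prop
  · intro i _
    refine hint _ ?_
    have := hφ'.continuous
    fun_prop

end Laplacian

section BallPotential

variable {m : ℕ}

/-- Density of the kernel of `ballPotential` in the polar-type coordinates `(t, w) ↦ t • w`. -/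
noncomputable def ballWeight (p : ℝ × EuclideanSpace ℝ (Fin m)) : ℝ :=
  (volume (ball (0 : EuclideanSpace ℝ (Fin m)) 1)).toReal⁻¹ * (p.1 * radialProfile p.2)

/-- A compactly supported potential whose Laplacian is the average of `φ` over balls of
radius `r` minus `φ`. -/
noncomputable def ballPotential (r : ℝ) (φ : EuclideanSpace ℝ (Fin m) → ℝ)
    (z : EuclideanSpace ℝ (Fin m)) : ℝ :=
  ∫ p in Ioc 0 r ×ˢ ball (0 : EuclideanSpace ℝ (Fin m)) 1, ballWeight p • φ (z - p.1 • p.2)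

lemma continuous_ballWeight : Continuous (ballWeight (m := m)) := by
  have := continuous_radialProfile (m := m)
  unfold ballWeight
  fun_prop

lemma Continuous.integrableOn_Ioc_prod_ball {f : ℝ × EuclideanSpace ℝ (Fin m) → ℝ}
    (hf : Continuous f) (r : ℝ) :
    IntegrableOn f (Ioc 0 r ×ˢ ball (0 : EuclideanSpace ℝ (Fin m)) 1) :=
  (hf.continuousOn.integrableOn_compact (isCompact_Icc.prod (isCompact_closedBall 0 1))).mono_set
    (prod_mono Ioc_subset_Icc_self ball_subset_closedBall)

lemma contDiff_ballPotential (r : ℝ) {φ : EuclideanSpace ℝ (Fin m) → ℝ}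
    (hφ : ContDiff ℝ (⊤ : ℕ∞) φ) (hφs : HasCompactSupport φ) :
    ContDiff ℝ (⊤ : ℕ∞) (ballPotential r φ) :=
  contDiff_integral_smul_comp_sub (continuous_ballWeight.integrableOn_Ioc_prod_ball r)
    (measurable_fst.smul measurable_snd) hφ hφs

lemma volume_ball_toReal_pos (z : EuclideanSpace ℝ (Fin m)) {r : ℝ} (hr : 0 < r) :
    0 < (volume (ball z r)).toReal :=
  ENNReal.toReal_pos (measure_ball_pos _ _ hr).ne' measure_ball_lt_top.ne

lemma abs_ballPotential_le {r : ℝ} (hr : 0 < r) {φ : EuclideanSpace ℝ (Fin m) → ℝ}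
    (hφ : ∀ z, |φ z| ≤ 1) (z : EuclideanSpace ℝ (Fin m)) : |ballPotential r φ z| ≤ r ^ 2 := by
  have hc := volume_ball_toReal_pos (0 : EuclideanSpace ℝ (Fin m)) one_pos
  have hvol : volume.real (Ioc 0 r ×ˢ ball (0 : EuclideanSpace ℝ (Fin m)) 1) =
      r * (volume (ball (0 : EuclideanSpace ℝ (Fin m)) 1)).toReal := by
    rw [Measure.real, Measure.volume_eq_prod, Measure.prod_prod, ENNReal.toReal_mul,
      Real.volume_Ioc, sub_zero, ENNReal.toReal_ofReal hr.le]
  have hfin : volume (Ioc 0 r ×ˢ ball (0 : EuclideanSpace ℝ (Fin m)) 1) < ⊤ := by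
    rw [Measure.volume_eq_prod, Measure.prod_prod]
    exact ENNReal.mul_lt_top (by simp) measure_ball_lt_top
  have h := norm_setIntegral_le_of_norm_le_const (f := fun p : ℝ × EuclideanSpace ℝ (Fin m) =>
      ballWeight p • φ (z - p.1 • p.2))
    (C := (volume (ball (0 : EuclideanSpace ℝ (Fin m)) 1)).toReal⁻¹ * r) hfin fun p hp => by
      have h1 : |p.1 * radialProfile p.2| ≤ r := by
        rw [abs_mul, abs_of_pos hp.1.1, abs_of_nonneg (radialProfile_nonneg _)]
        exact (mul_le_mul hp.1.2 (radialProfile_le_one _) (radialProfile_nonneg _)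
          hr.le).trans_eq (mul_one r)
      rw [norm_smul, Real.norm_eq_abs, Real.norm_eq_abs, ballWeight, abs_mul,
        abs_of_pos (inv_pos.2 hc)]
      calc _ ≤ (volume (ball (0 : EuclideanSpace ℝ (Fin m)) 1)).toReal⁻¹ * r * 1 := by
            gcongr
            exact hφ _
        _ = _ := mul_one _
  rw [hvol] at h
  refine h.trans_eq ?_
  field_simp

lemma support_ballPotential_subset (r : ℝ) (φ : EuclideanSpace ℝ (Fin m) → ℝ) :
    Function.support (ballPotential r φ) ⊆ thickening r (Function.support φ) := by
  intro z hz
  by_contra hz'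
  refine hz (setIntegral_eq_zero_of_forall_eq_zero fun p hp => ?_)
  have hp2 : ‖p.2‖ < 1 := by simpa using hp.2
  have : φ (z - p.1 • p.2) = 0 := by
    by_contra h
    refine hz' (mem_thickening_iff.2 ⟨_, h, ?_⟩)
    rw [dist_eq_norm, sub_sub_cancel, norm_smul, Real.norm_eq_abs, abs_of_pos hp.1.1]
    nlinarith [hp.1.1, hp.1.2, norm_nonneg p.2]
  rw [this, smul_zero]

lemma average_ball_eq {r : ℝ} (hr : 0 < r) (φ : EuclideanSpace ℝ (Fin m) → ℝ)
    (z : EuclideanSpace ℝ (Fin m)) :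
    (volume (ball z r)).toReal⁻¹ * ∫ w in ball z r, φ w =
      (volume (ball (0 : EuclideanSpace ℝ (Fin m)) 1)).toReal⁻¹ *
        ∫ w in ball (0 : EuclideanSpace ℝ (Fin m)) 1, φ (z - r • w) := by
  have hint : ∫ w in ball (0 : EuclideanSpace ℝ (Fin m)) 1, φ (z - r • w) =
      (r ^ m)⁻¹ * ∫ w in ball z r, φ w := by
    rw [← integral_indicator measurableSet_ball, ← integral_indicator measurableSet_ball]
    have hind : ∀ w : EuclideanSpace ℝ (Fin m),
        (ball (0 : EuclideanSpace ℝ (Fin m)) 1).indicator (fun w => φ (z - r • w)) w =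
          (ball z r).indicator φ (z - r • w) := by
      intro w
      have : w ∈ ball (0 : EuclideanSpace ℝ (Fin m)) 1 ↔ z - r • w ∈ ball z r := by
        rw [mem_ball_zero_iff, mem_ball, dist_eq_norm, sub_sub_cancel_left, norm_neg, norm_smul,
          Real.norm_eq_abs, abs_of_pos hr, mul_lt_iff_lt_one_right hr]
      by_cases hw : w ∈ ball (0 : EuclideanSpace ℝ (Fin m)) 1
      · rw [indicator_of_mem hw, indicator_of_mem (this.1 hw)]
      · rw [indicator_of_notMem hw, indicator_of_notMem (mt this.2 hw)]
    simp_rw [hind]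
    rw [Measure.integral_comp_smul volume (fun y => (ball z r).indicator φ (z - y)) r,
      integral_sub_left_eq_self, finrank_euclideanSpace_fin, smul_eq_mul,
      abs_of_pos (by positivity)]
  have hvol : (volume (ball z r)).toReal =
      r ^ m * (volume (ball (0 : EuclideanSpace ℝ (Fin m)) 1)).toReal := by
    rw [Measure.addHaar_ball_of_pos volume z hr, ENNReal.toReal_mul, finrank_euclideanSpace_fin,
      ENNReal.toReal_ofReal (by positivity)]
  rw [hint, hvol, mul_inv]
  ring

lemma lap_ballPotential {r : ℝ} (hr : 0 < r) {φ : EuclideanSpace ℝ (Fin m) → ℝ}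
    (hφ : ContDiff ℝ 2 φ) (hφs : HasCompactSupport φ) (z : EuclideanSpace ℝ (Fin m)) :
    lap (ballPotential r φ) z =
      (volume (ball z r)).toReal⁻¹ * (∫ w in ball z r, φ w) - φ z := by
  have hc := (volume_ball_toReal_pos (0 : EuclideanSpace ℝ (Fin m)) one_pos).ne'
  have hφc := hφ.continuous
  have hφ'c : Continuous (fderiv ℝ φ) := hφ.continuous_fderiv two_ne_zero
  have hlap := continuous_lap hφ
  have hprof := continuous_radialProfile (m := m)
  have hweight := continuous_ballWeight (m := m)
  have hL : lap (ballPotential r φ) z =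
      ∫ p in Ioc 0 r ×ˢ ball (0 : EuclideanSpace ℝ (Fin m)) 1,
        ballWeight p * lap φ (z - p.1 • p.2) :=
    lap_integral_smul_comp_sub (continuous_ballWeight.integrableOn_Ioc_prod_ball r)
      (measurable_fst.smul measurable_snd) hφ hφs z
  have hftc : ∀ w : EuclideanSpace ℝ (Fin m),
      ∫ t in Ioc 0 r, -fderiv ℝ φ (z - t • w) w = φ (z - r • w) - φ z := by
    intro w
    have hd : ∀ t ∈ uIcc 0 r,
        HasDerivAt (fun t : ℝ => φ (z - t • w)) (-fderiv ℝ φ (z - t • w) w) t := by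
      intro t _
      have h0 : HasDerivAt (fun t : ℝ => z - t • w) (-((1 : ℝ) • w)) t :=
        ((hasDerivAt_id t).smul_const w).const_sub z
      have h1 : HasDerivAt (fun t : ℝ => φ (z - t • w))
          (fderiv ℝ φ (z - t • w) (-((1 : ℝ) • w))) t :=
        ((hφ.differentiable two_ne_zero) (z - t • w)).hasFDerivAt.comp_hasDerivAt t h0
      rwa [one_smul, map_neg] at h1
    rw [← intervalIntegral.integral_of_le hr.le,
      intervalIntegral.integral_eq_sub_of_hasDerivAt hd
        (Continuous.intervalIntegrable (by fun_prop) _ _)]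
    simp
  have hI1 : IntegrableOn (fun p : ℝ × EuclideanSpace ℝ (Fin m) =>
      ballWeight p * lap φ (z - p.1 • p.2)) (Ioc 0 r ×ˢ ball 0 1) :=
    Continuous.integrableOn_Ioc_prod_ball (by fun_prop) r
  have hI2 : IntegrableOn (fun p : ℝ × EuclideanSpace ℝ (Fin m) =>
      -fderiv ℝ φ (z - p.1 • p.2) p.2) (Ioc 0 r ×ˢ ball 0 1) :=
    Continuous.integrableOn_Ioc_prod_ball (by fun_prop) r
  have hI3 : IntegrableOn (fun w : EuclideanSpace ℝ (Fin m) => φ (z - r • w)) (ball 0 1) :=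
    ((show Continuous fun w : EuclideanSpace ℝ (Fin m) => φ (z - r • w) by
      fun_prop).continuousOn.integrableOn_compact (isCompact_closedBall 0 1)).mono_set
      ball_subset_closedBall
  have hslice : ∀ t ∈ Ioc 0 r,
      ∫ w in ball (0 : EuclideanSpace ℝ (Fin m)) 1, ballWeight (t, w) * lap φ (z - t • w) =
      (volume (ball (0 : EuclideanSpace ℝ (Fin m)) 1)).toReal⁻¹ *
        ∫ w in ball (0 : EuclideanSpace ℝ (Fin m)) 1, -fderiv ℝ φ (z - t • w) w := by
    intro t ht
    rw [integral_neg, setIntegral_ball_fderiv_apply_self hφ hφs z ht.1.ne', neg_neg,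
      ← integral_const_mul]
    simp only [ballWeight, mul_assoc]
  rw [Measure.volume_eq_prod] at hL hI1 hI2
  rw [IntegrableOn, ← Measure.prod_restrict] at hI2
  rw [hL, setIntegral_prod _ hI1, setIntegral_congr_fun measurableSet_Ioc hslice,
    integral_const_mul, integral_integral_swap hI2, average_ball_eq hr]
  simp_rw [hftc]
  rw [integral_sub hI3 (integrableOn_const measure_ball_lt_top.ne), setIntegral_const,
    Measure.real, smul_eq_mul, mul_sub, inv_mul_cancel_left₀ hc]

lemma integrable_mul_mul_indicator_ball {φ U : EuclideanSpace ℝ (Fin m) → ℝ}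
    (hφ : Integrable φ) (hU : Integrable U) (r : ℝ) :
    Integrable (fun p : EuclideanSpace ℝ (Fin m) × EuclideanSpace ℝ (Fin m) =>
      φ p.1 * (ball p.1 r).indicator U p.2) (volume.prod volume) := by
  have hmeas : MeasurableSet
      {p : EuclideanSpace ℝ (Fin m) × EuclideanSpace ℝ (Fin m) | dist p.2 p.1 < r} :=
    measurableSet_lt (by fun_prop) measurable_const
  refine ((hφ.mul_prod hU).indicator hmeas).congr (Filter.Eventually.of_forall fun p => ?_)
  by_cases hp : dist p.2 p.1 < r <;> simp [indicator, hp]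

lemma integrable_mul_setIntegral_ball {φ U : EuclideanSpace ℝ (Fin m) → ℝ}
    (hφ : Integrable φ) (hU : Integrable U) (r : ℝ) :
    Integrable (fun z => φ z * ∫ w in ball z r, U w) := by
  refine (integrable_mul_mul_indicator_ball hφ hU r).integral_prod_left.congr
    (Filter.Eventually.of_forall fun z => ?_)
  dsimp only
  rw [integral_const_mul, integral_indicator measurableSet_ball]

lemma integral_mul_setIntegral_ball_comm {φ U : EuclideanSpace ℝ (Fin m) → ℝ}
    (hφ : Integrable φ) (hU : Integrable U) (r : ℝ) :
    ∫ z, φ z * ∫ w in ball z r, U w = ∫ w, U w * ∫ z in ball w r, φ z := by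
  simp_rw [← integral_indicator measurableSet_ball, ← integral_const_mul]
  rw [integral_integral_swap (integrable_mul_mul_indicator_ball hφ hU r)]
  refine integral_congr_ae (Filter.Eventually.of_forall fun w =>
    integral_congr_ae (Filter.Eventually.of_forall fun z => ?_))
  beta_reduce
  by_cases h : dist w z < r
  · rw [indicator_of_mem (mem_ball.2 h), indicator_of_mem (mem_ball'.2 h), mul_comm]
  · rw [indicator_of_notMem (mt mem_ball.1 h), indicator_of_notMem (mt mem_ball'.1 h), mul_zero,
      mul_zero]

lemma integral_mul_average_sub_comm {φ U : EuclideanSpace ℝ (Fin m) → ℝ}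
    (hφ : Continuous φ) (hφs : HasCompactSupport φ) (hU : Integrable U) (r : ℝ) :
    Integrable (fun z => φ z * ((volume (ball z r)).toReal⁻¹ * (∫ w in ball z r, U w) - U z)) ∧
    ∫ z, φ z * ((volume (ball z r)).toReal⁻¹ * (∫ w in ball z r, U w) - U z) =
      ∫ w, U w * ((volume (ball w r)).toReal⁻¹ * (∫ z in ball w r, φ z) - φ w) := by
  have hφi : Integrable φ := hφ.integrable_of_hasCompactSupport hφs
  obtain ⟨C, hC⟩ := hφs.exists_bound_of_continuous hφ
  have hφU : Integrable fun z => φ z * U z :=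
    hU.bdd_mul hφ.aestronglyMeasurable (Filter.Eventually.of_forall hC)
  have hUφ : Integrable fun z => U z * φ z := by simpa only [mul_comm] using hφU
  have h1 := (integrable_mul_setIntegral_ball hφi hU r).const_mul
    (volume (ball (0 : EuclideanSpace ℝ (Fin m)) r)).toReal⁻¹
  have h2 := (integrable_mul_setIntegral_ball hU hφi r).const_mul
    (volume (ball (0 : EuclideanSpace ℝ (Fin m)) r)).toReal⁻¹
  simp_rw [Measure.addHaar_ball_center volume _ r, mul_sub, mul_left_comm (φ _),
    mul_left_comm (U _)]
  refine ⟨h1.sub hφU, ?_⟩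
  rw [integral_sub h1 hφU, integral_sub h2 hUφ, integral_const_mul, integral_const_mul,
    integral_mul_setIntegral_ball_comm hφi hU]
  simp_rw [mul_comm (φ _)]

end BallPotential

lemma IsCompact.exists_contDiff_one_on_of_pos {E : Type*} [NormedAddCommGroup E]
    [NormedSpace ℝ E] [FiniteDimensional ℝ E] {K : Set E} (hK : IsCompact K) {ε : ℝ}
    (hε : 0 < ε) :
    ∃ φ : E → ℝ, ContDiff ℝ (⊤ : ℕ∞) φ ∧ HasCompactSupport φ ∧ (∀ z, 0 ≤ φ z) ∧
      (∀ z, φ z ≤ 1) ∧ Function.support φ = thickening ε K ∧ ∀ z ∈ K, φ z = 1 := by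
  obtain ⟨φ, hφ, hrange, hsupp, hone⟩ :=
    exists_contMDiff_support_eq_eq_one_iff (modelWithCornersSelf ℝ E) (n := ⊤)
      (isOpen_thickening (δ := ε) (E := K)) hK.isClosed (self_subset_thickening hε K)
  refine ⟨φ, hφ.contDiff, ?_, fun z => (hrange (mem_range_self z)).1,
    fun z => (hrange (mem_range_self z)).2, hsupp, fun z hz => (hone z).1 hz⟩
  refine (hK.cthickening (r := ε)).of_isClosed_subset (isClosed_tsupport φ) ?_
  rw [tsupport, hsupp]
  exact closure_thickening_subset_cthickening ε K

/-- Averaged Riesz-mass bound: for `u` subharmonic on `Ω` with Riesz measure `μ`, `K`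
compact with `K + B(0,√δ₀) ⋐ Ω` and finite Riesz mass `μ(K + B(0,√δ₀))`, one has
`∫_K (û_{√δ} − u) dV ≤ C δ μ(K + B(0,√δ₀))` for all `δ ∈ (0,δ₀)`, with `C = C(m)`. -/
theorem averaged_riesz_mass_bound (m : ℕ) :
    ∃ C : ℝ, 0 < C ∧
      ∀ (Ω K : Set (EuclideanSpace ℝ (Fin m))) (u : EuclideanSpace ℝ (Fin m) → ℝ)
        (μ : Measure (EuclideanSpace ℝ (Fin m))) (δ₀ : ℝ),
        IsOpen Ω → IsCompact K → 0 < δ₀ → δ₀ < 1 →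
        closure (K + Metric.ball 0 (Real.sqrt δ₀)) ⊆ Ω →
        IsCompact (closure (K + Metric.ball 0 (Real.sqrt δ₀))) →
        IsSubharmonicOn Ω u →
        IntegrableOn u (K + Metric.ball 0 (Real.sqrt δ₀)) volume →
        (∀ φ : EuclideanSpace ℝ (Fin m) → ℝ, ContDiff ℝ (⊤ : ℕ∞) φ →
          tsupport φ ⊆ Ω → IsCompact (tsupport φ) →
          ∫ x, u x * lap φ x = ∫ x, φ x ∂μ) →
        μ (K + Metric.ball 0 (Real.sqrt δ₀)) ≠ ⊤ →
        ∀ δ : ℝ, 0 < δ → δ < δ₀ →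
          ∫ z in K,
              ((volume (Metric.ball z (Real.sqrt δ))).toReal⁻¹ *
                  (∫ w in Metric.ball z (Real.sqrt δ), u w) - u z)
            ≤ C * δ * (μ (K + Metric.ball 0 (Real.sqrt δ₀))).toReal := by
  refine ⟨1, one_pos, ?_⟩
  intro Ω K u μ δ₀ _ hK hδ₀ _ hcl _ hu huint hμ hfin δ hδ hδδ₀
  rw [add_ball_zero] at hcl huint hfin ⊢
  set R := Real.sqrt δ₀
  set r := Real.sqrt δ
  have hr0 : 0 < r := Real.sqrt_pos.2 hδ
  have hrR : r < R := Real.sqrt_lt_sqrt hδ.le hδδ₀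
  have hSΩ : thickening R K ⊆ Ω := subset_closure.trans hcl
  obtain ⟨φ, hφ, hφs, hφ0, hφ1, hsupp, hφK⟩ :=
    hK.exists_contDiff_one_on_of_pos (half_pos (sub_pos.2 hrR))
  have hφ2 : ContDiff ℝ 2 φ := contDiff_infty.1 hφ 2
  have hball : ∀ z, φ z ≠ 0 → closedBall z r ⊆ thickening R K := by
    intro z hz y hy
    obtain ⟨x, hx, hzx⟩ := mem_thickening_iff.1 (hsupp ▸ (show z ∈ Function.support φ from hz))
    refine mem_thickening_iff.2 ⟨x, hx, ?_⟩
    have := dist_triangle y z x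
    rw [mem_closedBall] at hy
    linarith
  set ψ := ballPotential r φ with hψ
  have hψsupp : tsupport ψ ⊆ cthickening (r + (R - r) / 2) K := by
    refine (closure_mono ((support_ballPotential_subset r φ).trans ?_)).trans
      (closure_thickening_subset_cthickening _ K)
    rw [hsupp]
    exact thickening_thickening_subset _ _ K
  have hψS : tsupport ψ ⊆ thickening R K :=
    hψsupp.trans (cthickening_subset_thickening' (by linarith) (by linarith) K)
  have hψc : IsCompact (tsupport ψ) :=
    hK.cthickening.of_isClosed_subset (isClosed_tsupport ψ) hψsupp
  have hriesz := hμ ψ (contDiff_ballPotential r hφ hφs) (hψS.trans hSΩ) hψc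
  have hmass : ∫ x, ψ x ∂μ ≤ δ * (μ (thickening R K)).toReal := by
    rw [← setIntegral_eq_integral_of_forall_compl_eq_zero (s := thickening R K)
      fun x hx => image_eq_zero_of_notMem_tsupport fun h => hx (hψS h)]
    refine (le_abs_self _).trans
      (norm_setIntegral_le_of_norm_le_const (f := ψ) (C := δ) hfin.lt_top fun x _ => ?_)
    rw [← Real.sq_sqrt hδ.le]
    exact abs_ballPotential_le hr0 (fun z => abs_le.2 ⟨by linarith [hφ0 z], hφ1 z⟩) x
  set U := (thickening R K).indicator u with hU
  have hUint : Integrable U := huint.integrable_indicator isOpen_thickening.measurableSet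
  have hUu : ∀ z, φ z * ((volume (ball z r)).toReal⁻¹ * (∫ w in ball z r, U w) - U z) =
      φ z * ((volume (ball z r)).toReal⁻¹ * (∫ w in ball z r, u w) - u z) := by
    intro z
    by_cases hz : φ z = 0
    · rw [hz, zero_mul, zero_mul]
    · rw [hU, indicator_of_mem (hball z hz (mem_closedBall_self hr0.le)),
        setIntegral_congr_fun measurableSet_ball fun w hw =>
          indicator_of_mem (hball z hz (ball_subset_closedBall hw)) u]
  have huψ : ∀ x, u x * lap ψ x =
      U x * ((volume (ball x r)).toReal⁻¹ * (∫ z in ball x r, φ z) - φ x) := by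
    intro x
    rw [hψ, lap_ballPotential hr0 hφ2 hφs]
    by_cases hx : x ∈ thickening R K
    · rw [hU, indicator_of_mem hx]
    · have h0 : ∀ z ∈ closedBall x r, φ z = 0 := fun z hz => by
        by_contra h
        exact hx (hball z h (mem_closedBall_comm.1 hz))
      rw [h0 x (mem_closedBall_self hr0.le), setIntegral_eq_zero_of_forall_eq_zero fun z hz =>
        h0 z (ball_subset_closedBall hz)]
      simp
  obtain ⟨hint, heq⟩ := integral_mul_average_sub_comm hφ.continuous hφs hUint r
  simp_rw [hUu] at hint heq
  simp_rw [← huψ] at heq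
  have hnonneg : ∀ z,
      0 ≤ φ z * ((volume (ball z r)).toReal⁻¹ * (∫ w in ball z r, u w) - u z) := by
    intro z
    by_cases hz : φ z = 0
    · rw [hz, zero_mul]
    · exact mul_nonneg (hφ0 z) (sub_nonneg.2 (hu.2 z r hr0 ((hball z hz).trans hSΩ)))
  calc _ = ∫ z in K, φ z * ((volume (ball z r)).toReal⁻¹ * (∫ w in ball z r, u w) - u z) :=
        setIntegral_congr_fun hK.measurableSet fun z hz => by simp [hφK z hz]
    _ ≤ ∫ z, φ z * ((volume (ball z r)).toReal⁻¹ * (∫ w in ball z r, u w) - u z) :=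
        setIntegral_le_integral hint (Filter.Eventually.of_forall hnonneg)
    _ = ∫ x, ψ x ∂μ := heq.trans hriesz
    _ ≤ 1 * δ * (μ (thickening R K)).toReal := by rwa [one_mul]
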